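/- Weight-function characterisation of EC-spaces on compact intervals: let a < b and let E ⊆ C^n([a,b]) be an (n+1)-dimensional linear space. Then: (A) E is an EC-space on [a,b] if and only if there exists a system (w_0, …, w_n) of weight functions on [a,b] such that E = EC(w_0, …, w_n); (B) E is an EC-space good for design on [a,b] (E contains the constants and DE = {F' : F ∈ E} is an EC-space on [a,b]) if and only if there exists a system (w_1, …, w_n) of weight functions (w_i ∈ C^{n−i}([a,b]), positive) with E = EC(1, w_1, …, w_n). -/

import Mathlib

open scoped BigOperators

noncomputable section

/-- `F` vanishes to order at least `m` at `x`, derivatives being taken within `J`. -/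
def VanishAtLeastW (J : Set ℝ) (F : ℝ → ℝ) (m : ℕ) (x : ℝ) : Prop :=
  ∀ j < m, iteratedDerivWithin j F J x = 0

/-- `F` vanishes at most `N` times in `J`, counting multiplicities up to `μ`
(derivatives within `J`). -/
def VanishAtMostW (J : Set ℝ) (F : ℝ → ℝ) (μ N : ℕ) : Prop :=
  ∀ (r : ℕ) (xs : Fin r → ℝ) (m : Fin r → ℕ),
    (∀ i, xs i ∈ J) → Function.Injective xs →
    (∀ i, 1 ≤ m i) → (∀ i, m i ≤ μ) →
    (∀ i, VanishAtLeastW J F (m i) (xs i)) →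
    ∑ i, m i ≤ N

/-- Generalised derivatives `L_0 F = F / w 0`, `L_{i+1} F = (L_i F)' / w (i+1)`
(derivatives within `J`). -/
def genD (J : Set ℝ) (w : ℕ → ℝ → ℝ) : ℕ → (ℝ → ℝ) → ℝ → ℝ
  | 0, F => fun x => F x / w 0 x
  | i + 1, F => fun x => derivWithin (genD J w i F) J x / w (i + 1) x

/-- `(w 0, …, w n)` is a system of weight functions on `J`: each `w i` is of class
`C^(n-i)` and positive on `J`. -/
def IsWeightSystem (J : Set ℝ) (n : ℕ) (w : ℕ → ℝ → ℝ) : Prop :=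
  ∀ i ≤ n, ContDiffOn ℝ ((n - i : ℕ)) (w i) J ∧ ∀ x ∈ J, 0 < w i x

/-- The space `EC(w 0, …, w n)` on `J`: the `C^n` functions on `J` whose `n`-th generalised
derivative is constant on `J`. -/
def ECspace (J : Set ℝ) (n : ℕ) (w : ℕ → ℝ → ℝ) : Set (ℝ → ℝ) :=
  {F | ContDiffOn ℝ n F J ∧ ∃ c : ℝ, ∀ x ∈ J, genD J w n F x = c}


lemma val_congr {J : Set ℝ} {F G : ℝ → ℝ} {m : ℕ} {x : ℝ} (h : ∀ y ∈ J, F y = G y) (hx : x ∈ J)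
    (hF : VanishAtLeastW J F m x) : VanishAtLeastW J G m x := by
  intro j hj
  rw [← hF j hj]
  exact (iteratedDerivWithin_congr (n := j) (fun y hy => (h y hy).symm) hx)

lemma val_succ {J : Set ℝ} {F : ℝ → ℝ} {m : ℕ} {x : ℝ} :
    VanishAtLeastW J F (m + 1) x ↔ F x = 0 ∧ VanishAtLeastW J (derivWithin F J) m x := by
  constructor
  · intro h
    refine ⟨by simpa using h 0 (Nat.succ_pos _), fun j hj => ?_⟩
    have := h (j + 1) (by omega)
    rwa [iteratedDerivWithin_succ'] at this
  · rintro ⟨h0, h1⟩ j hj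
    rcases j with _ | j
    · simpa using h0
    · rw [iteratedDerivWithin_succ']
      exact h1 j (by omega)

lemma val_mono {J : Set ℝ} {F : ℝ → ℝ} {m k : ℕ} {x : ℝ} (h : k ≤ m)
    (hF : VanishAtLeastW J F m x) : VanishAtLeastW J F k x := fun j hj => hF j (by omega)

lemma cd_succ {J : Set ℝ} (hJ : UniqueDiffOn ℝ J) {n : ℕ} {f : ℝ → ℝ} :
    ContDiffOn ℝ ((n + 1 : ℕ)) f J ↔
      DifferentiableOn ℝ f J ∧ ContDiffOn ℝ (n : ℕ) (derivWithin f J) J := by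
  have : ((n + 1 : ℕ) : WithTop ℕ∞) = (n : WithTop ℕ∞) + 1 := by push_cast; rfl
  rw [this, contDiffOn_succ_iff_derivWithin hJ]
  simp

lemma val_add {J : Set ℝ} (hJ : UniqueDiffOn ℝ J) {x : ℝ} (hx : x ∈ J) :
    ∀ (m : ℕ) (F g : ℝ → ℝ), ContDiffOn ℝ (m : ℕ) F J → ContDiffOn ℝ (m : ℕ) g J →
      VanishAtLeastW J F (m + 1) x → VanishAtLeastW J g (m + 1) x →
      VanishAtLeastW J (fun y => F y + g y) (m + 1) x := by
  intro m
  induction m with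
  | zero =>
    intro F g _ _ hF hg
    rw [val_succ] at *
    exact ⟨by simp [hF.1, hg.1], fun j hj => by omega⟩
  | succ m ih =>
    intro F g hF hg hvF hvg
    rw [val_succ] at *
    rw [cd_succ hJ] at hF hg
    refine ⟨by simp [hvF.1, hvg.1], ?_⟩
    refine val_congr ?_ hx (ih _ _ hF.2 hg.2 hvF.2 hvg.2)
    intro y hy
    exact (derivWithin_fun_add (hF.1 y hy) (hg.1 y hy)).symm

lemma val_mul {J : Set ℝ} (hJ : UniqueDiffOn ℝ J) {x : ℝ} (hx : x ∈ J) :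
    ∀ (m : ℕ) (F g : ℝ → ℝ), ContDiffOn ℝ (m : ℕ) F J → ContDiffOn ℝ (m : ℕ) g J →
      VanishAtLeastW J F (m + 1) x →
      VanishAtLeastW J (fun y => F y * g y) (m + 1) x := by
  intro m
  induction m with
  | zero =>
    intro F g _ _ hF
    rw [val_succ] at *
    exact ⟨by simp [hF.1], fun j hj => by omega⟩
  | succ m ih =>
    intro F g hF hg hvF
    have hF0 : ContDiffOn ℝ (m : ℕ) F J := hF.of_le (by exact_mod_cast Nat.le_succ m)
    have hg0 : ContDiffOn ℝ (m : ℕ) g J := hg.of_le (by exact_mod_cast Nat.le_succ m)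
    have hv0 := val_mono (Nat.le_succ _) hvF
    rw [val_succ] at hvF
    rw [val_succ]
    rw [cd_succ hJ] at hF hg
    refine ⟨by simp [hvF.1], ?_⟩
    refine val_congr ?_ hx (val_add hJ hx m _ _ (hF.2.mul hg0) (hF0.mul hg.2)
      (ih _ _ hF.2 hg0 hvF.2) (ih _ _ hF0 hg.2 hv0))
    intro y hy
    exact (derivWithin_fun_mul (hF.1 y hy) (hg.1 y hy)).symm

/-- Finset version of `VanishAtMostW`. -/
def VFin (J : Set ℝ) (F : ℝ → ℝ) (μ N : ℕ) : Prop :=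
  ∀ (S : Finset ℝ) (m : ℝ → ℕ), (∀ x ∈ S, x ∈ J) → (∀ x ∈ S, m x ≤ μ) →
    (∀ x ∈ S, VanishAtLeastW J F (m x) x) → ∑ x ∈ S, m x ≤ N

lemma vfin_iff {J : Set ℝ} {F : ℝ → ℝ} {μ N : ℕ} : VFin J F μ N ↔ VanishAtMostW J F μ N := by
  constructor
  · intro h r xs m hJ hinj h1 hμ hv
    classical
    let m' : ℝ → ℕ := fun x => ∑ i, if xs i = x then m i else 0
    have hm' : ∀ i, m' (xs i) = m i := by
      intro i
      simp only [m', hinj.eq_iff]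
      simp
    have := h (Finset.univ.image xs) m' (by simpa using hJ)
      (by simpa [hm'] using hμ) (by simpa [hm'] using hv)
    rw [Finset.sum_image (fun i _ j _ hij => hinj hij)] at this
    simpa [hm'] using this
  · intro h S m hJ hμ hv
    classical
    let T := S.filter (fun x => m x ≠ 0)
    have hT : ∑ x ∈ S, m x = ∑ x ∈ T, m x := by
      rw [Finset.sum_filter_ne_zero]
    have hTS : ∀ i : Fin T.card, ((T.equivFin.symm i : T) : ℝ) ∈ S ∧ m (T.equivFin.symm i) ≠ 0 := by
      intro i
      exact Finset.mem_filter.1 (T.equivFin.symm i).2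
    have := h T.card (fun i => (T.equivFin.symm i : T)) (fun i => m (T.equivFin.symm i : T))
      (fun i => hJ _ (hTS i).1)
      (fun i j hij => T.equivFin.symm.injective (Subtype.ext hij))
      (fun i => Nat.one_le_iff_ne_zero.2 (hTS i).2)
      (fun i => hμ _ (hTS i).1) (fun i => hv _ (hTS i).1)
    rw [hT, ← Finset.sum_coe_sort T]
    rw [Equiv.sum_comp T.equivFin.symm (fun x : T => m x)] at this
    exact this

lemma rolle_mult {a b : ℝ} {f : ℝ → ℝ} (hd : ContinuousOn f (Set.Icc a b))
    (S : Finset ℝ) (m : ℝ → ℕ) (μ : ℕ) (hμ1 : 1 ≤ μ) (hS : ∀ x ∈ S, x ∈ Set.Icc a b)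
    (hμ : ∀ x ∈ S, m x ≤ μ + 1) (hv : ∀ x ∈ S, VanishAtLeastW (Set.Icc a b) f (m x) x) :
    ∃ (S' : Finset ℝ) (m' : ℝ → ℕ), (∀ x ∈ S', x ∈ Set.Icc a b) ∧ (∀ x ∈ S', m' x ≤ μ) ∧
      (∀ x ∈ S', VanishAtLeastW (Set.Icc a b) (derivWithin f (Set.Icc a b)) (m' x) x) ∧
      ∑ x ∈ S, m x ≤ ∑ x ∈ S', m' x + 1 := by
  classical
  set J := Set.Icc a b with hJ
  let s := S.filter (fun x => m x ≠ 0)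
  have hs : ∀ x ∈ s, x ∈ S ∧ m x ≠ 0 := fun x hx => Finset.mem_filter.1 hx
  have hsum : ∑ x ∈ S, m x = ∑ x ∈ s, m x := by rw [Finset.sum_filter_ne_zero]
  have hval : ∀ x ∈ s, f x = 0 ∧ VanishAtLeastW J (derivWithin f J) (m x - 1) x := by
    intro x hx
    have h1 := hv x (hs x hx).1
    have : m x = (m x - 1) + 1 := by have := (hs x hx).2; omega
    rw [this] at h1
    exact val_succ.1 h1
  have key : ∀ x y : ℝ, ∃ z : ℝ, x ∈ s → y ∈ s → x < y →
      x < z ∧ z < y ∧ z ∈ J ∧ derivWithin f J z = 0 := by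
    intro x y
    by_cases h : x ∈ s ∧ y ∈ s ∧ x < y
    · obtain ⟨hx, hy, hxy⟩ := h
      have hxJ := hS x (hs x hx).1
      have hyJ := hS y (hs y hy).1
      obtain ⟨z, hz, hz0⟩ := exists_deriv_eq_zero hxy
        (hd.mono (Set.Icc_subset_Icc hxJ.1 hyJ.2)) ((hval x hx).1.trans (hval y hy).1.symm)
      refine ⟨z, fun _ _ _ => ⟨hz.1, hz.2, ⟨hxJ.1.trans hz.1.le, hz.2.le.trans hyJ.2⟩, ?_⟩⟩
      rw [derivWithin_of_mem_nhds, hz0]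
      exact Icc_mem_nhds (hxJ.1.trans_lt hz.1) (hz.2.trans_le hyJ.2)
    · exact ⟨0, fun hx hy hxy => absurd ⟨hx, hy, hxy⟩ h⟩
  choose z hz using key
  let t : Finset ℝ := ((s ×ˢ s).filter (fun p => p.1 < p.2)).image (fun p => z p.1 p.2)
  have ht : ∀ y ∈ t, y ∈ J ∧ derivWithin f J y = 0 := by
    intro y hy
    obtain ⟨p, hp, rfl⟩ := Finset.mem_image.1 hy
    rw [Finset.mem_filter, Finset.mem_product] at hp
    exact (hz p.1 p.2 hp.1.1 hp.1.2 hp.2).2.2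
  have hcard : s.card ≤ (t \ s).card + 1 := by
    apply Finset.card_le_sdiff_of_interleaved
    intro x hx y hy hxy _
    have := hz x y hx hy hxy
    exact ⟨z x y, Finset.mem_image.2 ⟨(x, y), by simp [hx, hy, hxy], rfl⟩, this.1, this.2.1⟩
  refine ⟨s ∪ (t \ s), fun x => if x ∈ s then m x - 1 else 1, ?_, ?_, ?_, ?_⟩
  · intro x hx
    rcases Finset.mem_union.1 hx with h | h
    · exact hS x (hs x h).1
    · exact (ht x (Finset.mem_sdiff.1 h).1).1
  · intro x hx
    dsimp only
    split_ifs with h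
    · have := hμ x (hs x h).1
      omega
    · exact hμ1
  · intro x hx
    dsimp only
    split_ifs with h
    · exact (hval x h).2
    · have h2 := (Finset.mem_union.1 hx).resolve_left h
      intro j hj
      have : j = 0 := by omega
      subst this
      simpa using (ht x (Finset.mem_sdiff.1 h2).1).2
  · rw [Finset.sum_union Finset.disjoint_sdiff, hsum]
    have e1 : ∑ x ∈ s, (if x ∈ s then m x - 1 else 1) = ∑ x ∈ s, (m x - 1) :=
      Finset.sum_congr rfl fun x hx => by simp [hx]
    have e2 : ∑ x ∈ t \ s, (if x ∈ s then m x - 1 else 1) = (t \ s).card := by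
      rw [Finset.card_eq_sum_ones]
      exact Finset.sum_congr rfl fun x hx => by simp [(Finset.mem_sdiff.1 hx).2]
    have e3 : ∑ x ∈ s, m x = ∑ x ∈ s, (m x - 1) + s.card := by
      rw [Finset.card_eq_sum_ones, ← Finset.sum_add_distrib]
      exact Finset.sum_congr rfl fun x hx => by have := (hs x hx).2; omega
    rw [e1, e2, e3]
    omega

/-- Enough zeros force a zero of the `l`-th derivative. -/
lemma rolle_iter {a b : ℝ} (hab : a < b) : ∀ (l : ℕ) (f : ℝ → ℝ),
    ContDiffOn ℝ (l : ℕ) f (Set.Icc a b) → ∀ (S : Finset ℝ) (m : ℝ → ℕ),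
    (∀ x ∈ S, x ∈ Set.Icc a b) → (∀ x ∈ S, VanishAtLeastW (Set.Icc a b) f (m x) x) →
    l + 1 ≤ ∑ x ∈ S, m x → ∃ y ∈ Set.Icc a b, iteratedDerivWithin l f (Set.Icc a b) y = 0 := by
  intro l
  induction l with
  | zero =>
    intro f _ S m hS hv hl
    have : ∃ x ∈ S, m x ≠ 0 := by
      by_contra! h
      rw [Finset.sum_eq_zero h] at hl
      omega
    obtain ⟨x, hx, hm⟩ := this
    exact ⟨x, hS x hx, hv x hx 0 (Nat.pos_of_ne_zero hm)⟩
  | succ l ih =>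
    intro f hf S m hS hv hl
    have hJ := uniqueDiffOn_Icc hab
    obtain ⟨S', m', h1, -, h3, h4⟩ := rolle_mult hf.continuousOn S m (1 + ∑ x ∈ S, m x) (by omega)
      hS (fun x hx => by
        have := Finset.single_le_sum (f := m) (fun i _ => Nat.zero_le _) hx
        omega) hv
    rw [cd_succ hJ] at hf
    rw [iteratedDerivWithin_succ']
    exact ih _ hf.2 S' m' h1 h3 (by omega)

lemma genD_shift (J : Set ℝ) (w : ℕ → ℝ → ℝ) (F : ℝ → ℝ) (i : ℕ) :
    genD J w (i + 1) F =
      genD J (fun k => w (k + 1)) i (derivWithin (fun x => F x / w 0 x) J) := by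
  induction i with
  | zero => rfl
  | succ i ih =>
    funext x
    change derivWithin (genD J w (i + 1) F) J x / w (i + 1 + 1) x = _
    rw [ih]
    rfl

lemma genD_congr {J : Set ℝ} {w : ℕ → ℝ → ℝ} {F G : ℝ → ℝ} (h : ∀ x ∈ J, F x = G x) (i : ℕ) :
    ∀ x ∈ J, genD J w i F x = genD J w i G x := by
  induction i with
  | zero => intro x hx; simp [genD, h x hx]
  | succ i ih =>
    intro x hx
    simp only [genD]
    rw [derivWithin_congr ih (ih x hx)]

lemma ec_congr {J : Set ℝ} {n : ℕ} {w : ℕ → ℝ → ℝ} {F G : ℝ → ℝ} (h : ∀ x ∈ J, F x = G x)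
    (hF : F ∈ ECspace J n w) : G ∈ ECspace J n w := by
  obtain ⟨h1, c, hc⟩ := hF
  refine ⟨h1.congr (fun x hx => (h x hx).symm), c, fun x hx => ?_⟩
  rw [← hc x hx]
  exact genD_congr (fun y hy => (h y hy).symm) n x hx

lemma weight_shift {J : Set ℝ} {n : ℕ} {w : ℕ → ℝ → ℝ} (h : IsWeightSystem J (n + 1) w) :
    IsWeightSystem J n (fun k => w (k + 1)) := by
  intro i hi
  have := h (i + 1) (by omega)
  rwa [Nat.add_sub_add_right] at this

/-- Prepend a weight. -/
def wcons (w0 : ℝ → ℝ) (w : ℕ → ℝ → ℝ) : ℕ → ℝ → ℝ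
  | 0 => w0
  | k + 1 => w k

lemma weight_cons {J : Set ℝ} {n : ℕ} {w0 : ℝ → ℝ} {w : ℕ → ℝ → ℝ} (h : IsWeightSystem J n w)
    (h0 : ContDiffOn ℝ ((n + 1 : ℕ)) w0 J) (hp : ∀ x ∈ J, 0 < w0 x) :
    IsWeightSystem J (n + 1) (wcons w0 w) := by
  intro i hi
  rcases i with _ | i
  · exact ⟨h0, hp⟩
  · have := h i (by omega)
    rwa [Nat.add_sub_add_right]

lemma mem_ec_succ {J : Set ℝ} (hJ : UniqueDiffOn ℝ J) {n : ℕ} {w : ℕ → ℝ → ℝ}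
    (h0 : ContDiffOn ℝ ((n + 1 : ℕ)) (w 0) J) (hp : ∀ x ∈ J, 0 < w 0 x) {F : ℝ → ℝ} :
    F ∈ ECspace J (n + 1) w ↔ ContDiffOn ℝ ((n + 1 : ℕ)) F J ∧
      derivWithin (fun x => F x / w 0 x) J ∈ ECspace J n (fun k => w (k + 1)) := by
  constructor
  · rintro ⟨h1, c, hc⟩
    refine ⟨h1, ?_, c, ?_⟩
    · exact ((cd_succ hJ).1 (h1.div h0 (fun x hx => (hp x hx).ne'))).2
    · rw [genD_shift] at hc
      exact hc
  · rintro ⟨h1, -, c, hc⟩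
    refine ⟨h1, c, ?_⟩
    rw [genD_shift]
    exact hc

lemma const_of_deriv {a b : ℝ} {f : ℝ → ℝ} (hd : DifferentiableOn ℝ f (Set.Icc a b))
    (h : ∀ x ∈ Set.Icc a b, derivWithin f (Set.Icc a b) x = 0) :
    ∀ x ∈ Set.Icc a b, f x = f a :=
  constant_of_derivWithin_zero hd fun x hx => h x (Set.Ico_subset_Icc_self hx)

lemma ec_zeros {a b : ℝ} (hab : a < b) : ∀ (n : ℕ) (w : ℕ → ℝ → ℝ),
    IsWeightSystem (Set.Icc a b) n w → ∀ F ∈ ECspace (Set.Icc a b) n w,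
    ¬ (∀ x ∈ Set.Icc a b, F x = 0) → VFin (Set.Icc a b) F (n + 1) n := by
  have hJ := uniqueDiffOn_Icc hab
  -- a function proportional to the first weight
  have prop : ∀ (F w0 : ℝ → ℝ) (c : ℝ) (μ N : ℕ), (∀ x ∈ Set.Icc a b, 0 < w0 x) →
      (∀ x ∈ Set.Icc a b, F x / w0 x = c) → ¬ (∀ x ∈ Set.Icc a b, F x = 0) →
      VFin (Set.Icc a b) F μ N := by
    intro F w0 c μ N hp hc hF S m hS _ hv
    have hF' : ∀ x ∈ Set.Icc a b, F x = c * w0 x := fun x hx => by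
      rw [← hc x hx, div_mul_cancel₀ _ (hp x hx).ne']
    have hc0 : c ≠ 0 := by
      rintro rfl
      exact hF fun x hx => by rw [hF' x hx, zero_mul]
    rw [Finset.sum_eq_zero]
    · omega
    · intro x hx
      by_contra hm
      have := hv x hx 0 (Nat.pos_of_ne_zero hm)
      rw [iteratedDerivWithin_zero, hF' x (hS x hx)] at this
      exact mul_ne_zero hc0 (hp x (hS x hx)).ne' this
  intro n
  induction n with
  | zero =>
    intro w hw F hF hF0
    obtain ⟨_, c, hc⟩ := hF
    exact prop F (w 0) c _ _ (hw 0 le_rfl).2 hc hF0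
  | succ n ih =>
    intro w hw F hF hF0
    have hw0 := hw 0 (by omega)
    rw [Nat.sub_zero] at hw0
    have hF1 := (mem_ec_succ hJ hw0.1 hw0.2).1 hF
    set G : ℝ → ℝ := fun x => F x / w 0 x with hG
    have hGc : ContDiffOn ℝ ((n + 1 : ℕ)) G (Set.Icc a b) :=
      hF1.1.div hw0.1 (fun x hx => (hw0.2 x hx).ne')
    by_cases hD : ∀ x ∈ Set.Icc a b, derivWithin G (Set.Icc a b) x = 0
    · have := const_of_deriv ((cd_succ hJ).1 hGc).1 hD
      exact prop F (w 0) (G a) _ _ hw0.2 this hF0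
    · have h2 := ih _ (weight_shift hw) _ hF1.2 hD
      intro S m hS hμ hv
      have hvG : ∀ x ∈ S, VanishAtLeastW (Set.Icc a b) G (m x) x := by
        intro x hx
        rcases hm : m x with _ | k
        · intro j hj; omega
        · have hk : k ≤ n + 1 := by have := hμ x hx; omega
          have hv' := hv x hx
          rw [hm] at hv'
          have hkk : ((k : ℕ) : WithTop ℕ∞) ≤ ((n + 1 : ℕ) : WithTop ℕ∞) := by exact_mod_cast hk
          have := val_mul hJ (hS x hx) k F (fun y => (w 0 y)⁻¹) (hF1.1.of_le hkk)
            ((hw0.1.inv (fun x hx => (hw0.2 x hx).ne')).of_le hkk) hv'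
          exact this
      obtain ⟨S', m', q1, q2, q3, q4⟩ := rolle_mult hGc.continuousOn S m (n + 1) (by omega) hS hμ hvG
      have := h2 S' m' q1 q2 q3
      omega

lemma sign_lemma {a b : ℝ} {f : ℝ → ℝ} (hf : ContinuousOn f (Set.Icc a b))
    (h0 : ∀ x ∈ Set.Icc a b, f x ≠ 0) : ∃ σ : ℝ, ∀ x ∈ Set.Icc a b, 0 < σ * f x := by
  by_cases hne : (Set.Icc a b).Nonempty
  · obtain ⟨p, hp⟩ := hne
    refine ⟨f p, fun x hx => ?_⟩
    by_contra! hle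
    have hc : ContinuousOn (fun y => f p * f y) (Set.Icc a b) := continuousOn_const.mul hf
    obtain ⟨y, hy, hy0⟩ := (isPreconnected_Icc.intermediate_value hx hp hc)
      (show (0 : ℝ) ∈ Set.Icc _ _ from ⟨hle, mul_self_nonneg _⟩)
    exact mul_ne_zero (h0 p hp) (h0 y hy) hy0
  · exact ⟨0, fun x hx => absurd ⟨x, hx⟩ hne⟩

/-- A nested family of spaces with nonvanishing Wronskians. -/
def IsFlag (J : Set ℝ) (n : ℕ) (u : ℕ → ℝ → ℝ) : Prop :=
  (∀ i ≤ n, ContDiffOn ℝ (n : ℕ) (u i) J) ∧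
  ∀ k ≤ n, ∀ x ∈ J, ∀ c : ℕ → ℝ,
    VanishAtLeastW J (fun y => ∑ i ∈ Finset.range (k + 1), c i * u i y) (k + 1) x →
    ∀ i ≤ k, c i = 0

lemma derivWithin_comb {J : Set ℝ} {N : ℕ} {f : ℕ → ℝ → ℝ} {c : ℕ → ℝ} {y : ℝ}
    (hf : ∀ i < N, DifferentiableWithinAt ℝ (f i) J y) :
    derivWithin (fun z => ∑ i ∈ Finset.range N, c i * f i z) J y =
      ∑ i ∈ Finset.range N, c i * derivWithin (f i) J y := by
  have : HasDerivWithinAt (fun z => ∑ i ∈ Finset.range N, c i * f i z)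
      (∑ i ∈ Finset.range N, c i * derivWithin (f i) J y) J y := by
    apply HasDerivWithinAt.fun_sum
    intro i hi
    exact ((hf i (Finset.mem_range.1 hi)).hasDerivWithinAt).const_mul (c i)
  by_cases hu : UniqueDiffWithinAt ℝ J y
  · exact this.derivWithin hu
  · rw [derivWithin_zero_of_not_uniqueDiffWithinAt hu]
    rw [Finset.sum_eq_zero]
    intro i _
    rw [derivWithin_zero_of_not_uniqueDiffWithinAt hu, mul_zero]

lemma flag_weights {a b : ℝ} (hab : a < b) : ∀ (n : ℕ) (u : ℕ → ℝ → ℝ),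
    IsFlag (Set.Icc a b) n u → ∃ w, IsWeightSystem (Set.Icc a b) n w ∧
      ∀ F, F ∈ ECspace (Set.Icc a b) n w ↔
        ∃ c : ℕ → ℝ, ∀ x ∈ Set.Icc a b, F x = ∑ i ∈ Finset.range (n + 1), c i * u i x := by
  have hJ := uniqueDiffOn_Icc hab
  have hu0 : ∀ n u, IsFlag (Set.Icc a b) n u → ∀ x ∈ Set.Icc a b, u 0 x ≠ 0 := by
    intro n u hu x hx h0
    have := hu.2 0 (Nat.zero_le _) x hx (fun _ => 1) (by
      intro j hj
      have : j = 0 := by omega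
      subst this
      simp [h0]) 0 le_rfl
    norm_num at this
  intro n
  induction n with
  | zero =>
    intro u hu
    have hc0 := hu.1 0 le_rfl
    obtain ⟨σ, hσ⟩ := sign_lemma hc0.continuousOn (hu0 0 u hu)
    have hs0 : σ ≠ 0 := by
      rintro rfl
      have := hσ a ⟨le_rfl, hab.le⟩
      simp at this
    refine ⟨fun _ x => σ * u 0 x, fun i hi => ?_, fun F => ?_⟩
    · have : i = 0 := by omega
      subst this
      exact ⟨contDiffOn_const.mul hc0, hσ⟩
    · constructor
      · rintro ⟨_, c, hc⟩
        refine ⟨fun _ => c * σ, fun x hx => ?_⟩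
        have := hc x hx
        simp only [genD] at this
        rw [div_eq_iff (hσ x hx).ne'] at this
        simp [this, mul_assoc]
      · rintro ⟨c, hc⟩
        refine ⟨(contDiffOn_const.mul hc0 : ContDiffOn ℝ _ (fun x => c 0 * u 0 x) _).congr
          (fun x hx => by simpa using hc x hx), c 0 / σ, fun x hx => ?_⟩
        simp only [genD]
        have h1 := hu0 0 u hu x hx
        rw [hc x hx]
        simp
        field_simp
  | succ n ih =>
    intro u hu
    have hc0 := hu.1 0 (by omega)
    obtain ⟨σ, hσ⟩ := sign_lemma hc0.continuousOn (hu0 _ u hu)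
    have hs0 : σ ≠ 0 := by
      rintro rfl
      have := hσ a ⟨le_rfl, hab.le⟩
      simp at this
    set w0 : ℝ → ℝ := fun x => σ * u 0 x with hw0
    have hwc : ContDiffOn ℝ ((n + 1 : ℕ)) w0 (Set.Icc a b) := contDiffOn_const.mul hc0
    have hwne : ∀ x ∈ Set.Icc a b, w0 x ≠ 0 := fun x hx => (hσ x hx).ne'
    set q : ℕ → ℝ → ℝ := fun i x => u (i + 1) x / w0 x with hq
    have hqc : ∀ i ≤ n, ContDiffOn ℝ ((n + 1 : ℕ)) (q i) (Set.Icc a b) := fun i hi =>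
      (hu.1 (i + 1) (by omega)).div hwc hwne
    have hqd : ∀ i ≤ n, DifferentiableOn ℝ (q i) (Set.Icc a b) := fun i hi =>
      ((cd_succ hJ).1 (hqc i hi)).1
    have hv : IsFlag (Set.Icc a b) n (fun i => derivWithin (q i) (Set.Icc a b)) := by
      refine ⟨fun i hi => ((cd_succ hJ).1 (hqc i hi)).2, ?_⟩
      intro k hk x hx c hvan
      set g : ℝ → ℝ := fun y => ∑ i ∈ Finset.range (k + 1), c i * q i y with hg
      have hgc : ContDiffOn ℝ ((k + 1 : ℕ)) g (Set.Icc a b) := by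
        apply ContDiffOn.sum
        intro i hi
        have := Finset.mem_range.1 hi
        exact contDiffOn_const.mul ((hqc i (by omega)).of_le (by exact_mod_cast (by omega)))
      have hh : VanishAtLeastW (Set.Icc a b) (fun y => g y - g x) (k + 1 + 1) x := by
        rw [val_succ]
        refine ⟨by simp, val_congr ?_ hx hvan⟩
        intro y hy
        rw [derivWithin_sub_const, hg, derivWithin_comb]
        intro i hi
        exact hqd i (by omega) y hy
      have hm := val_mul hJ hx (k + 1) _ w0 (hgc.sub contDiffOn_const)
        (hwc.of_le (by exact_mod_cast (by omega))) hh
      have := hu.2 (k + 1) (by omega) x hx (fun i => Nat.casesOn i (-(g x) * σ) c) (by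
        refine val_congr ?_ hx hm
        intro y hy
        have e1 : (g y - g x) * w0 y = g y * w0 y + -(g x) * σ * u 0 y := by
          simp only [hw0]
          ring
        rw [Finset.sum_range_succ', e1]
        congr 1
        simp only [hg, Finset.sum_mul]
        apply Finset.sum_congr rfl
        intro i _
        simp only [hq]
        rw [mul_assoc, div_mul_cancel₀ _ (hwne y hy)])
      intro i hi
      exact this (i + 1) (by omega)
    obtain ⟨w, hw, hec⟩ := ih _ hv
    refine ⟨wcons w0 w, weight_cons hw hwc hσ, fun F => ?_⟩
    rw [mem_ec_succ (w := wcons w0 w) hJ hwc hσ]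
    change _ ∧ derivWithin (fun x => F x / w0 x) (Set.Icc a b) ∈ ECspace (Set.Icc a b) n w ↔ _
    rw [hec]
    constructor
    · rintro ⟨hF, c, hc⟩
      have hFd : DifferentiableOn ℝ (fun x => F x / w0 x) (Set.Icc a b) :=
        ((cd_succ hJ).1 (hF.div hwc hwne)).1
      set g : ℝ → ℝ := fun y => ∑ i ∈ Finset.range (n + 1), c i * q i y with hg
      have hgd : DifferentiableOn ℝ g (Set.Icc a b) := by
        intro y hy
        apply DifferentiableWithinAt.fun_sum
        intro i hi
        exact ((hqd i (by have := Finset.mem_range.1 hi; omega)) y hy).const_mul _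
      have hk := const_of_deriv (hFd.sub hgd) (by
        intro x hx
        rw [derivWithin_sub (hFd x hx) (hgd x hx), hc x hx, hg, derivWithin_comb, sub_self]
        intro i hi
        exact hqd i (by omega) x hx)
      set K := ((fun x => F x / w0 x) - g) a
      refine ⟨fun i => Nat.casesOn i (K * σ) c, fun x hx => ?_⟩
      have h1 : F x / w0 x = K + g x := by
        have := hk x hx
        simp only [Pi.sub_apply] at this
        linarith
      rw [div_eq_iff (hwne x hx)] at h1
      rw [h1, Finset.sum_range_succ', add_mul, add_comm]
      congr 1
      · simp only [hg, Finset.sum_mul]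
        apply Finset.sum_congr rfl
        intro i _
        simp only [hq]
        rw [mul_assoc, div_mul_cancel₀ _ (hwne x hx)]
      · change K * (σ * u 0 x) = K * σ * u 0 x
        ring
    · rintro ⟨c, hc⟩
      constructor
      · refine ContDiffOn.congr ?_ hc
        apply ContDiffOn.sum
        intro i hi
        have := Finset.mem_range.1 hi
        exact contDiffOn_const.mul (hu.1 i (by omega))
      · refine ⟨fun i => c (i + 1), fun x hx => ?_⟩
        have he : ∀ y ∈ Set.Icc a b, F y / w0 y =
            (∑ i ∈ Finset.range (n + 1), c (i + 1) * q i y) + c 0 / σ := by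
          intro y hy
          rw [hc y hy, Finset.sum_range_succ', add_div, Finset.sum_div]
          congr 1
          · apply Finset.sum_congr rfl
            intro i _
            simp only [hq]
            ring
          · have := hu0 _ u hu y hy
            simp only [hw0]
            field_simp
        rw [derivWithin_congr he (he x hx), derivWithin_add_const,
          derivWithin_comb (c := fun i => c (i + 1))]
        intro i hi
        exact hqd i (by omega) x hx

lemma exists_extension {a b : ℝ} (hab : a < b) : ∀ (n : ℕ) (f : ℝ → ℝ),
    ContDiffOn ℝ (n : ℕ) f (Set.Icc a b) →
    ∃ g : ℝ → ℝ, ContDiff ℝ (n : ℕ) g ∧ ∀ x ∈ Set.Icc a b, g x = f x := by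
  have hJ := uniqueDiffOn_Icc hab
  intro n
  induction n with
  | zero =>
    intro f hf
    refine ⟨Set.IccExtend hab.le ((Set.Icc a b).restrict f), ?_, ?_⟩
    · simp only [Nat.cast_zero, contDiff_zero]
      exact (continuousOn_iff_continuous_restrict.1 hf.continuousOn).Icc_extend'
    · intro x hx
      rw [Set.IccExtend_of_mem _ _ hx]
      rfl
  | succ n ih =>
    intro f hf
    have hf' := (cd_succ hJ).1 hf
    obtain ⟨h, hc, he⟩ := ih _ hf'.2
    have hd : ∀ x, HasDerivAt (fun t => f a + ∫ s in a..t, h s) (h x) x := by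
      intro x
      exact (hc.continuous.integral_hasStrictDerivAt a x).hasDerivAt.const_add _
    refine ⟨fun t => f a + ∫ s in a..t, h s, ?_, ?_⟩
    · have : ((n + 1 : ℕ) : WithTop ℕ∞) = (n : WithTop ℕ∞) + 1 := by push_cast; rfl
      rw [this, contDiff_succ_iff_deriv]
      refine ⟨fun x => (hd x).differentiableAt, by simp, ?_⟩
      have : deriv (fun t => f a + ∫ s in a..t, h s) = h := funext fun x => (hd x).deriv
      rw [this]
      exact hc
    · intro x hx
      have hgd : DifferentiableOn ℝ (fun t => f a + ∫ s in a..t, h s) (Set.Icc a b) :=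
        fun y _ => (hd y).differentiableAt.differentiableWithinAt
      have := const_of_deriv (hgd.sub hf'.1) (by
        intro y hy
        rw [derivWithin_sub (hgd y hy) (hf'.1 y hy), (hd y).hasDerivWithinAt.derivWithin (hJ y hy),
          he y hy, sub_self]) x hx
      simp only [Pi.sub_apply, intervalIntegral.integral_same] at this
      linarith

/-- The `l`-th derivative at `y` of a linear combination, as a linear form in the coefficients. -/
def jetL {N : ℕ} (g : Fin N → ℝ → ℝ) (l : ℕ) (y : ℝ) : (Fin N → ℝ) →ₗ[ℝ] ℝ where
  toFun v := ∑ i, v i * iteratedDeriv l (g i) y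
  map_add' v w := by simp [add_mul, Finset.sum_add_distrib]
  map_smul' t v := by simp [mul_assoc, Finset.mul_sum]

lemma jetL_apply {N : ℕ} (g : Fin N → ℝ → ℝ) (l : ℕ) (y : ℝ) (v : Fin N → ℝ) :
    jetL g l y v = ∑ i, v i * iteratedDeriv l (g i) y := rfl

lemma contDiff_comb {N n : ℕ} {g : Fin N → ℝ → ℝ} (hg : ∀ i, ContDiff ℝ (n : ℕ) (g i))
    (v : Fin N → ℝ) : ContDiff ℝ (n : ℕ) (fun y => ∑ i, v i * g i y) :=
  ContDiff.sum fun i _ => contDiff_const.mul (hg i)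

lemma iteratedDeriv_comb {N n : ℕ} {g : Fin N → ℝ → ℝ} (hg : ∀ i, ContDiff ℝ (n : ℕ) (g i))
    (v : Fin N → ℝ) {l : ℕ} (hl : l ≤ n) (x : ℝ) :
    iteratedDeriv l (fun y => ∑ i, v i * g i y) x = jetL g l x v := by
  have hg' : ∀ i, ContDiff ℝ (l : ℕ) (g i) := fun i => (hg i).of_le (by exact_mod_cast hl)
  rw [jetL_apply, iteratedDeriv_fun_sum (fun i _ => (contDiff_const.mul (hg' i)).contDiffAt)]
  refine Finset.sum_congr rfl fun i _ => ?_
  exact iteratedDeriv_const_mul (v i) (hg' i).contDiffAt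

lemma iteratedDerivWithin_comb {N n : ℕ} {g : Fin N → ℝ → ℝ}
    (hg : ∀ i, ContDiff ℝ (n : ℕ) (g i)) (v : Fin N → ℝ) {l : ℕ} (hl : l ≤ n) {p q x : ℝ}
    (hpq : p < q) (hx : x ∈ Set.Icc p q) :
    iteratedDerivWithin l (fun y => ∑ i, v i * g i y) (Set.Icc p q) x = jetL g l x v := by
  rw [iteratedDerivWithin_eq_iteratedDeriv (uniqueDiffOn_Icc hpq) _ hx, iteratedDeriv_comb hg v hl]
  exact ((contDiff_comb hg v).of_le (by exact_mod_cast hl)).contDiffAt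

lemma jetL_continuous {N n : ℕ} {g : Fin N → ℝ → ℝ}
    (hg : ∀ i, ContDiff ℝ (n : ℕ) (g i)) {l : ℕ} (hl : l ≤ n) :
    Continuous (fun z : (Fin N → ℝ) × ℝ => jetL g l z.2 z.1) := by
  simp only [jetL_apply]
  refine continuous_finsetSum _ fun i _ => ?_
  have := (hg i).continuous_iteratedDeriv l (by exact_mod_cast hl)
  fun_prop

lemma exists_left_point {a b : ℝ} (n : ℕ) {N : ℕ} (g : Fin N → ℝ → ℝ)
    (hg : ∀ i, ContDiff ℝ (n : ℕ) (g i))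
    (h1 : ∀ v : Fin N → ℝ, v ≠ 0 → ∃ l ≤ n, jetL g l a v ≠ 0)
    (h2 : ∀ v : Fin N → ℝ, v ≠ 0 → ∀ x ∈ Set.Icc a b, x ≠ a → ∀ i ≤ n + 1,
      (∃ l < i, jetL g l a v ≠ 0) ∨ (∃ l < n + 1 - i, jetL g l x v ≠ 0)) :
    ∃ c : ℝ, ∀ v : Fin N → ℝ, v ≠ 0 → ∀ x ∈ Set.Icc a b, ∀ i ≤ n + 1,
      (∃ l < i, jetL g l c v ≠ 0) ∨ (∃ l < n + 1 - i, jetL g l x v ≠ 0) := by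
  have main : ∀ i ∈ Finset.range (n + 2), ∀ᶠ ε : ℝ in nhds 0,
      ∀ z ∈ (Metric.sphere (0 : Fin N → ℝ) 1) ×ˢ (Set.Icc a b), 0 < ε → a ≤ z.2 →
      (∃ l < i, jetL g l (a - ε) z.1 ≠ 0) ∨ (∃ l < n + 1 - i, jetL g l z.2 z.1 ≠ 0) := by
    intro i hi
    have hi' : i ≤ n + 1 := by have := Finset.mem_range.1 hi; omega
    apply IsCompact.eventually_forall_of_forall_eventually
      ((isCompact_sphere _ _).prod isCompact_Icc)
    rintro ⟨v0, x0⟩ ⟨hv0, hx0⟩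
    simp only at hv0 hx0
    have hv : v0 ≠ 0 := by
      rintro rfl
      simp at hv0
    by_cases hxa : x0 = a
    · subst hxa
      obtain ⟨l, hl, hne⟩ := h1 v0 hv
      have hev := (jetL_continuous hg hl).continuousAt.eventually_ne
        (x := ((v0, x0) : (Fin N → ℝ) × ℝ)) (y := 0) hne
      rw [nhds_prod_eq, Filter.eventually_prod_iff] at hev
      obtain ⟨pa, hpa, pb, hpb, hpp⟩ := hev
      obtain ⟨δ, hδ, hball⟩ := Metric.eventually_nhds_iff.1 hpb
      have t1 : ∀ᶠ z : ℝ × ((Fin N → ℝ) × ℝ) in nhds (0, (v0, x0)), pa z.2.1 :=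
        (show Continuous (fun z : ℝ × ((Fin N → ℝ) × ℝ) => z.2.1) by fun_prop).continuousAt.eventually
          (show ∀ᶠ y in nhds v0, pa y from hpa)
      have t2 : ∀ᶠ z : ℝ × ((Fin N → ℝ) × ℝ) in nhds (0, (v0, x0)), z.1 < δ :=
        ContinuousAt.eventually_lt continuous_fst.continuousAt continuousAt_const hδ
      have t3 : ∀ᶠ z : ℝ × ((Fin N → ℝ) × ℝ) in nhds (0, (v0, x0)), z.2.2 < x0 + δ :=
        ContinuousAt.eventually_lt (by fun_prop) continuousAt_const (by simpa using hδ)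
      filter_upwards [t1, t2, t3]
      rintro ⟨ε, v, x⟩ q1 q2 q3 hε hax
      simp only at q1 q2 q3 hε hax ⊢
      by_contra! hcon
      have hlt : x0 - ε < x := by linarith
      obtain ⟨y, hy, hy0⟩ := rolle_iter hlt l (fun y => ∑ i, v i * g i y)
        ((contDiff_comb hg v).of_le (by exact_mod_cast hl)).contDiffOn
        {x0 - ε, x} (fun y => if y = x0 - ε then i else n + 1 - i)
        (by
          intro y hy
          simp only [Finset.mem_insert, Finset.mem_singleton] at hy
          rcases hy with rfl | rfl
          · exact ⟨le_rfl, hlt.le⟩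
          · exact ⟨hlt.le, le_rfl⟩)
        (by
          intro y hy
          simp only [Finset.mem_insert, Finset.mem_singleton] at hy
          rcases hy with rfl | rfl
          · rw [if_pos rfl]
            intro j hj
            rw [iteratedDerivWithin_comb hg v (by omega) hlt ⟨le_rfl, hlt.le⟩]
            exact hcon.1 j hj
          · rw [if_neg hlt.ne']
            intro j hj
            rw [iteratedDerivWithin_comb hg v (by omega) hlt ⟨hlt.le, le_rfl⟩]
            exact hcon.2 j hj)
        (by
          rw [Finset.sum_pair hlt.ne, if_pos rfl, if_neg hlt.ne']
          omega)
      rw [iteratedDerivWithin_comb hg v hl hlt hy] at hy0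
      refine hpp q1 (hball ?_) hy0
      rw [Real.dist_eq, abs_lt]
      constructor <;> linarith [hy.1, hy.2]
    · rcases h2 v0 hv x0 hx0 hxa i hi' with ⟨l, hl, hne⟩ | ⟨l, hl, hne⟩
      · have hc : Continuous (fun z : ℝ × ((Fin N → ℝ) × ℝ) => jetL g l (a - z.1) z.2.1) :=
          (jetL_continuous hg (show l ≤ n by omega)).comp
            (show Continuous (fun z : ℝ × ((Fin N → ℝ) × ℝ) => (z.2.1, a - z.1)) by fun_prop)
        have := hc.continuousAt.eventually_ne (x := ((0, v0, x0) : ℝ × ((Fin N → ℝ) × ℝ))) (y := 0)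
          (by simpa using hne)
        filter_upwards [this] with z hz _ _
        exact Or.inl ⟨l, hl, hz⟩
      · have hc : Continuous (fun z : ℝ × ((Fin N → ℝ) × ℝ) => jetL g l z.2.2 z.2.1) :=
          (jetL_continuous hg (show l ≤ n by omega)).comp
            (show Continuous (fun z : ℝ × ((Fin N → ℝ) × ℝ) => (z.2.1, z.2.2)) by fun_prop)
        have := hc.continuousAt.eventually_ne (x := ((0, v0, x0) : ℝ × ((Fin N → ℝ) × ℝ))) (y := 0)
          (by simpa using hne)
        filter_upwards [this] with z hz _ _
        exact Or.inr ⟨l, hl, hz⟩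
  rw [← Filter.eventually_all_finset] at main
  obtain ⟨ε, hε, hε0⟩ := ((main.filter_mono nhdsWithin_le_nhds).and
    (self_mem_nhdsWithin : Set.Ioi (0 : ℝ) ∈ nhdsWithin 0 (Set.Ioi 0))).exists
  refine ⟨a - ε, fun v hv x hx i hi => ?_⟩
  have hnv : ‖v‖ ≠ 0 := norm_ne_zero_iff.2 hv
  have := hε i (Finset.mem_range.2 (by omega)) (‖v‖⁻¹ • v, x)
    ⟨by simp [norm_smul, hnv], hx⟩ hε0 hx.1
  simp only [map_smul, smul_eq_mul, ne_eq, mul_eq_zero, inv_eq_zero, hnv, false_or] at this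
  exact this

theorem core {a b : ℝ} (hab : a < b) (n : ℕ) (e : Fin (n + 1) → ℝ → ℝ)
    (he : ∀ i, ContDiffOn ℝ (n : ℕ) (e i) (Set.Icc a b))
    (hEC : ∀ v : Fin (n + 1) → ℝ, v ≠ 0 →
      VFin (Set.Icc a b) (fun x => ∑ i, v i * e i x) (n + 1) n) :
    ∃ w, IsWeightSystem (Set.Icc a b) n w ∧
      ∀ F, F ∈ ECspace (Set.Icc a b) n w ↔
        ∃ v : Fin (n + 1) → ℝ, ∀ x ∈ Set.Icc a b, F x = ∑ i, v i * e i x := by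
  choose g hg hge using fun i => exists_extension hab n (e i) (he i)
  have haJ : a ∈ Set.Icc a b := ⟨le_rfl, hab.le⟩
  have hcomb : ∀ v : Fin (n + 1) → ℝ, ∀ x ∈ Set.Icc a b,
      ∑ i, v i * g i x = ∑ i, v i * e i x := fun v x hx =>
    Finset.sum_congr rfl fun i _ => by rw [hge i x hx]
  have hvan : ∀ v : Fin (n + 1) → ℝ, ∀ x ∈ Set.Icc a b, ∀ m ≤ n + 1,
      (∀ l < m, jetL g l x v = 0) →
      VanishAtLeastW (Set.Icc a b) (fun x => ∑ i, v i * e i x) m x := by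
    intro v x hx m hm h
    refine val_congr (hcomb v) hx ?_
    intro j hj
    rw [iteratedDerivWithin_comb hg v (by omega) hab hx]
    exact h j hj
  obtain ⟨c, hc⟩ := exists_left_point (a := a) (b := b) n g hg
    (by
      intro v hv
      by_contra! h
      have := hEC v hv {a} (fun _ => n + 1) (by simpa using haJ) (by simp) (by
        intro x hx
        rw [Finset.mem_singleton.1 hx]
        exact hvan v a haJ _ le_rfl fun l hl => h l (by omega))
      simp at this)
    (by
      intro v hv x hx hxa i hi
      by_contra! h
      have := hEC v hv {a, x} (fun y => if y = a then i else n + 1 - i)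
        (by
          intro y hy
          simp only [Finset.mem_insert, Finset.mem_singleton] at hy
          rcases hy with rfl | rfl
          exacts [haJ, hx])
        (by intro y hy; split_ifs <;> omega)
        (by
          intro y hy
          simp only [Finset.mem_insert, Finset.mem_singleton] at hy
          rcases hy with rfl | rfl
          · rw [if_pos rfl]
            exact hvan v _ haJ _ hi h.1
          · rw [if_neg hxa]
            exact hvan v _ hx _ (by omega) h.2)
      rw [Finset.sum_pair (Ne.symm hxa), if_pos rfl, if_neg hxa] at this
      omega)
  let T : (Fin (n + 1) → ℝ) →ₗ[ℝ] (Fin (n + 1) → ℝ) := LinearMap.pi fun l => jetL g l c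
  have hTinj : Function.Injective T := by
    rw [injective_iff_map_eq_zero]
    intro v hv
    by_contra hne
    rcases hc v hne a haJ (n + 1) le_rfl with ⟨l, hl, h⟩ | ⟨l, hl, h⟩
    · exact h (congrFun hv ⟨l, hl⟩)
    · omega
  have hTsurj : Function.Surjective T := LinearMap.injective_iff_surjective.1 hTinj
  have hV : ∀ k : ℕ, ∃ V : Fin (n + 1) → ℝ, ∀ l ≤ n,
      jetL g l c V = if l = n - k then 1 else 0 := by
    intro k
    obtain ⟨V, hV⟩ := hTsurj (fun l => if (l : ℕ) = n - k then 1 else 0)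
    exact ⟨V, fun l hl => congrFun hV ⟨l, by omega⟩⟩
  choose V hV using hV
  set u : ℕ → ℝ → ℝ := fun k y => ∑ i, V k i * g i y with hu
  have hsum : ∀ (k : ℕ) (d : ℕ → ℝ) (y : ℝ), ∑ j ∈ Finset.range k, d j * u j y =
      ∑ i, (∑ j ∈ Finset.range k, d j • V j) i * g i y := by
    intro k d y
    simp only [hu, Finset.mul_sum, Finset.sum_apply, Finset.sum_mul, Pi.smul_apply, smul_eq_mul]
    rw [Finset.sum_comm]
    simp only [mul_assoc]
  have hjet : ∀ (k : ℕ) (d : ℕ → ℝ) (l : ℕ), l ≤ n →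
      jetL g l c (∑ j ∈ Finset.range k, d j • V j) =
        ∑ j ∈ Finset.range k, d j * (if l = n - j then 1 else 0) := by
    intro k d l hl
    rw [map_sum]
    exact Finset.sum_congr rfl fun j _ => by rw [map_smul, hV j l hl, smul_eq_mul]
  have hcoef : ∀ (k : ℕ) (d : ℕ → ℝ) (i : ℕ), k ≤ n → i ≤ k →
      jetL g (n - i) c (∑ j ∈ Finset.range (k + 1), d j • V j) = d i := by
    intro k d i hk hi
    rw [hjet _ _ _ (by omega), Finset.sum_eq_single i]
    · simp
    · intro j hj hji
      have := Finset.mem_range.1 hj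
      rw [if_neg (by omega), mul_zero]
    · intro h
      exact absurd (Finset.mem_range.2 (by omega)) h
  have hflag : IsFlag (Set.Icc a b) n u := by
    refine ⟨fun i _ => (contDiff_comb hg (V i)).contDiffOn, ?_⟩
    intro k hk x hx d hd i hi
    set W := ∑ j ∈ Finset.range (k + 1), d j • V j with hW
    have hW0 : W = 0 := by
      by_contra hne
      rcases hc W hne x hx (n - k) (by omega) with ⟨l, hl, h⟩ | ⟨l, hl, h⟩
      · apply h
        rw [hW, hjet _ _ _ (by omega)]
        refine Finset.sum_eq_zero fun j hj => ?_
        have := Finset.mem_range.1 hj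
        rw [if_neg (by omega), mul_zero]
      · apply h
        have := hd l (by omega)
        simp only [hsum] at this
        rwa [iteratedDerivWithin_comb hg _ (by omega) hab hx] at this
    rw [← hcoef k d i hk hi, ← hW, hW0, map_zero]
  obtain ⟨w, hw, hE⟩ := flag_weights hab n u hflag
  refine ⟨w, hw, fun F => ?_⟩
  rw [hE]
  constructor
  · rintro ⟨d, hd⟩
    refine ⟨∑ j ∈ Finset.range (n + 1), d j • V j, fun x hx => ?_⟩
    rw [hd x hx, hsum, hcomb _ x hx]
  · rintro ⟨v, hv⟩
    refine ⟨fun i => jetL g (n - i) c v, fun x hx => ?_⟩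
    rw [hv x hx, hsum, ← hcomb v x hx]
    congr 2
    suffices h : v = ∑ j ∈ Finset.range (n + 1), (jetL g (n - j) c v) • V j by
      rw [← h]
    apply hTinj
    funext l
    have hl : (l : ℕ) ≤ n := by have := l.2; omega
    change jetL g l c v = jetL g l c _
    have := hcoef n (fun j => jetL g (n - j) c v) (n - l) le_rfl (by omega)
    rw [Nat.sub_sub_self hl] at this
    exact this.symm

lemma vfin_congr {J : Set ℝ} {F G : ℝ → ℝ} {μ N : ℕ} (h : ∀ x ∈ J, F x = G x)
    (hF : VFin J F μ N) : VFin J G μ N := fun S m hS hμ hv =>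
  hF S m hS hμ fun x hx => val_congr (fun y hy => (h y hy).symm) (hS x hx) (hv x hx)

lemma img_eq_iff {J : Set ℝ} {A B : Set (ℝ → ℝ)} :
    (fun F => J.restrict F) '' A = (fun F => J.restrict F) '' B ↔
      (∀ F ∈ A, ∃ G ∈ B, ∀ x ∈ J, G x = F x) ∧ (∀ F ∈ B, ∃ G ∈ A, ∀ x ∈ J, G x = F x) := by
  have key : ∀ F G : ℝ → ℝ, J.restrict F = J.restrict G ↔ ∀ x ∈ J, F x = G x := by
    intro F G
    constructor
    · intro h x hx
      exact congrFun h ⟨x, hx⟩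
    · intro h
      funext x
      exact h x x.2
  constructor
  · intro h
    constructor
    · intro F hF
      obtain ⟨G, hG, hGF⟩ := h.subset ⟨F, hF, rfl⟩
      exact ⟨G, hG, (key _ _).1 hGF⟩
    · intro F hF
      obtain ⟨G, hG, hGF⟩ := h.symm.subset ⟨F, hF, rfl⟩
      exact ⟨G, hG, (key _ _).1 hGF⟩
  · rintro ⟨h1, h2⟩
    apply Set.Subset.antisymm
    · rintro _ ⟨F, hF, rfl⟩
      obtain ⟨G, hG, h⟩ := h1 F hF
      exact ⟨G, hG, (key _ _).2 h⟩
    · rintro _ ⟨F, hF, rfl⟩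
      obtain ⟨G, hG, h⟩ := h2 F hF
      exact ⟨G, hG, (key _ _).2 h⟩

theorem core_sub {a b : ℝ} (hab : a < b) (n : ℕ) (E : Submodule ℝ (ℝ → ℝ))
    (hdim : Module.finrank ℝ E = n + 1)
    (hreg : ∀ F ∈ E, ContDiffOn ℝ (n : ℕ) F (Set.Icc a b))
    (hEC : ∀ F ∈ E, F ≠ 0 → VFin (Set.Icc a b) F (n + 1) n) :
    ∃ w, IsWeightSystem (Set.Icc a b) n w ∧
      ∀ F, F ∈ ECspace (Set.Icc a b) n w ↔ ∃ G ∈ E, ∀ x ∈ Set.Icc a b, G x = F x := by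
  have : Module.Finite ℝ E := Module.finite_of_finrank_pos (by omega)
  let B : Module.Basis (Fin (n + 1)) ℝ E := Module.finBasisOfFinrankEq ℝ E hdim
  have hB : ∀ (v : Fin (n + 1) → ℝ) (x : ℝ),
      ∑ i, v i * (B i : ℝ → ℝ) x = (B.equivFun.symm v : ℝ → ℝ) x := by
    intro v x
    rw [Module.Basis.equivFun_symm_apply]
    simp
  obtain ⟨w, hw, h⟩ := core hab n (fun i => (B i : ℝ → ℝ)) (fun i => hreg _ (B i).2) (by
    intro v hv
    have : (fun x => ∑ i, v i * (B i : ℝ → ℝ) x) = (B.equivFun.symm v : ℝ → ℝ) :=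
      funext (hB v)
    rw [this]
    refine hEC _ (B.equivFun.symm v).2 ?_
    intro h0
    apply hv
    have : B.equivFun.symm v = 0 := Subtype.ext h0
    exact (LinearEquiv.map_eq_zero_iff _).1 this)
  refine ⟨w, hw, fun F => ?_⟩
  rw [h]
  constructor
  · rintro ⟨v, hv⟩
    exact ⟨_, (B.equivFun.symm v).2, fun x hx => by rw [hv x hx, hB]⟩
  · rintro ⟨G, hG, hGF⟩
    refine ⟨B.equivFun ⟨G, hG⟩, fun x hx => ?_⟩
    rw [hB, ← hGF x hx, LinearEquiv.symm_apply_apply]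

/-- The derivative on `[a,b]`, extended by zero, as a linear map. -/
def derivMap {a b : ℝ} (E : Submodule ℝ (ℝ → ℝ))
    (hd : ∀ F ∈ E, DifferentiableOn ℝ F (Set.Icc a b)) : E →ₗ[ℝ] (ℝ → ℝ) where
  toFun F := (Set.Icc a b).indicator (derivWithin (F : ℝ → ℝ) (Set.Icc a b))
  map_add' F G := by
    funext x
    by_cases hx : x ∈ Set.Icc a b
    · simp only [Set.indicator_of_mem hx, Pi.add_apply, Submodule.coe_add]
      exact derivWithin_add (hd _ F.2 x hx) (hd _ G.2 x hx)
    · simp [Set.indicator_of_notMem hx]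
  map_smul' t F := by
    funext x
    by_cases hx : x ∈ Set.Icc a b
    · simp only [Set.indicator_of_mem hx, Pi.smul_apply, Submodule.coe_smul, RingHom.id_apply]
      exact derivWithin_const_smul t (hd _ F.2 x hx)
    · simp [Set.indicator_of_notMem hx]

theorem design_forward {a b : ℝ} (hab : a < b) (n : ℕ) (E : Submodule ℝ (ℝ → ℝ))
    (hdim : Module.finrank ℝ E = n + 1 + 1)
    (hreg : ∀ F ∈ E, ContDiffOn ℝ ((n + 1 : ℕ)) F (Set.Icc a b))
    (hinj : ∀ F ∈ E, (∀ x ∈ Set.Icc a b, F x = 0) → F = 0)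
    (h1 : ∃ G ∈ E, ∀ x ∈ Set.Icc a b, G x = 1)
    (hEC : ∀ F ∈ E, ¬ (∀ x ∈ Set.Icc a b, derivWithin F (Set.Icc a b) x = 0) →
      VFin (Set.Icc a b) (derivWithin F (Set.Icc a b)) (n + 1) n) :
    ∃ w : ℕ → ℝ → ℝ, w 0 = (fun _ => (1 : ℝ)) ∧ IsWeightSystem (Set.Icc a b) (n + 1) w ∧
      ∀ F, F ∈ ECspace (Set.Icc a b) (n + 1) w ↔ ∃ G ∈ E, ∀ x ∈ Set.Icc a b, G x = F x := by
  have hJ := uniqueDiffOn_Icc hab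
  have haJ : a ∈ Set.Icc a b := ⟨le_rfl, hab.le⟩
  have : Module.Finite ℝ E := Module.finite_of_finrank_pos (by omega)
  obtain ⟨G0, hG0, hG01⟩ := h1
  have hd : ∀ F ∈ E, DifferentiableOn ℝ F (Set.Icc a b) := fun F hF =>
    ((cd_succ hJ).1 (hreg F hF)).1
  set Φ := derivMap E hd with hΦ
  have hΦm : ∀ (F : E), ∀ x ∈ Set.Icc a b, Φ F x = derivWithin (F : ℝ → ℝ) (Set.Icc a b) x :=
    fun F x hx => Set.indicator_of_mem hx _
  have hΦn : ∀ (F : E), ∀ x ∉ Set.Icc a b, Φ F x = 0 :=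
    fun F x hx => Set.indicator_of_notMem hx _
  have hG0d : ∀ x ∈ Set.Icc a b, derivWithin G0 (Set.Icc a b) x = 0 := by
    intro x hx
    rw [derivWithin_congr (f := fun _ => (1 : ℝ)) hG01 (hG01 x hx)]
    simp
  have hker : Module.finrank ℝ (LinearMap.ker Φ) = 1 := by
    have hmem : (⟨G0, hG0⟩ : E) ∈ LinearMap.ker Φ := by
      rw [LinearMap.mem_ker]
      funext x
      by_cases hx : x ∈ Set.Icc a b
      · rw [hΦm _ x hx]
        exact hG0d x hx
      · exact hΦn _ x hx
    refine (finrank_eq_one_iff_of_nonzero' (⟨⟨G0, hG0⟩, hmem⟩ : LinearMap.ker Φ) ?_).2 ?_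
    · intro h
      have h2 : G0 = 0 := congrArg (fun z : LinearMap.ker Φ => ((z : E) : ℝ → ℝ)) h
      have := hG01 a haJ
      rw [h2] at this
      simp at this
    · rintro ⟨⟨F, hF⟩, hFk⟩
      have hconst := const_of_deriv (hd F hF) (by
        intro x hx
        rw [← hΦm ⟨F, hF⟩ x hx, LinearMap.mem_ker.1 hFk]
        rfl)
      refine ⟨F a, ?_⟩
      apply Subtype.ext
      apply Subtype.ext
      change F a • G0 = F
      have := hinj (F a • G0 - F) (E.sub_mem (E.smul_mem _ hG0) hF) (by
        intro x hx
        simp [hG01 x hx, hconst x hx])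
      exact sub_eq_zero.1 this
  have hrank : Module.finrank ℝ (LinearMap.range Φ) = n + 1 := by
    have := LinearMap.finrank_range_add_finrank_ker Φ
    omega
  obtain ⟨w, hw, hE⟩ := core_sub hab n (LinearMap.range Φ) hrank
    (by
      rintro _ ⟨F, rfl⟩
      exact ((cd_succ hJ).1 (hreg F F.2)).2.congr (hΦm F))
    (by
      rintro _ ⟨F, rfl⟩ hne
      refine vfin_congr (fun x hx => (hΦm F x hx).symm) (hEC F F.2 ?_)
      intro h0
      apply hne
      funext x
      by_cases hx : x ∈ Set.Icc a b
      · rw [hΦm F x hx, h0 x hx]; rfl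
      · exact hΦn F x hx)
  have h1c : ContDiffOn ℝ ((n + 1 : ℕ)) (fun _ : ℝ => (1 : ℝ)) (Set.Icc a b) := contDiffOn_const
  have h1p : ∀ x ∈ Set.Icc a b, (0 : ℝ) < (fun _ : ℝ => (1 : ℝ)) x := fun _ _ => one_pos
  refine ⟨wcons (fun _ => 1) w, rfl, weight_cons hw h1c h1p, fun F => ?_⟩
  rw [mem_ec_succ (w := wcons (fun _ => 1) w) hJ h1c h1p]
  change _ ∧ derivWithin (fun x => F x / 1) (Set.Icc a b) ∈ ECspace (Set.Icc a b) n w ↔ _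
  simp only [div_one]
  rw [hE]
  constructor
  · rintro ⟨hF, _, ⟨G, rfl⟩, hG⟩
    have hFd := ((cd_succ hJ).1 hF).1
    have hGd := hd G G.2
    have := const_of_deriv (hFd.sub hGd) (by
      intro x hx
      rw [derivWithin_sub (hFd x hx) (hGd x hx), ← hΦm G x hx, hG x hx]
      exact sub_self _)
    refine ⟨(G : ℝ → ℝ) + (F - (G : ℝ → ℝ)) a • G0, E.add_mem G.2 (E.smul_mem _ hG0), ?_⟩
    intro x hx
    have h2 := this x hx
    simp only [Pi.sub_apply, Pi.add_apply, Pi.smul_apply, hG01 x hx, smul_eq_mul, mul_one] at h2 ⊢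
    linarith
  · rintro ⟨G, hG, hGF⟩
    refine ⟨(hreg G hG).congr fun x hx => (hGF x hx).symm, Φ ⟨G, hG⟩, ⟨_, rfl⟩, ?_⟩
    intro x hx
    rw [hΦm _ x hx]
    exact derivWithin_congr hGF (hGF x hx)

lemma zero_mem_ec {J : Set ℝ} {w : ℕ → ℝ → ℝ} (n : ℕ) : (fun _ => (0 : ℝ)) ∈ ECspace J n w := by
  refine ⟨contDiffOn_const, 0, fun x _ => ?_⟩
  have : ∀ i, genD J w i (fun _ => (0 : ℝ)) = fun _ => 0 := by
    intro i
    induction i with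
    | zero => funext x; simp [genD]
    | succ i ih => funext x; simp [genD, ih]
  rw [this]

/-- weight-function characterisation of EC-spaces on compact intervals.
(A) an `(n+1)`-dimensional space `E ⊆ C^n([a,b])` is an EC-space on `[a,b]` iff
`E = EC(w_0, …, w_n)` for some system of weight functions on `[a,b]`;
(B) `E` is an EC-space good for design on `[a,b]` iff `E = EC(1, w_1, …, w_n)` for some
system of weight functions with `w_0 = 1`.  (Spaces of functions on `[a,b]` are compared via
their restrictions to `[a,b]`.) -/
theorem stmt18 (n : ℕ) (a b : ℝ) (hab : a < b)
    (E : Submodule ℝ (ℝ → ℝ))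
    (hdim : Module.finrank ℝ E = n + 1)
    (hreg : ∀ F ∈ E, ContDiffOn ℝ n F (Set.Icc a b))
    (hinj : ∀ F ∈ E, (∀ x ∈ Set.Icc a b, F x = 0) → F = 0) :
    ((∀ F ∈ E, F ≠ 0 → VanishAtMostW (Set.Icc a b) F (n + 1) n) ↔
      ∃ w : ℕ → ℝ → ℝ, IsWeightSystem (Set.Icc a b) n w ∧
        (fun F => (Set.Icc a b).restrict F) '' (E : Set (ℝ → ℝ)) =
          (fun F => (Set.Icc a b).restrict F) '' ECspace (Set.Icc a b) n w) ∧
    (((∃ G ∈ E, ∀ x ∈ Set.Icc a b, G x = 1) ∧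
        ∀ G ∈ {G : ℝ → ℝ | ∃ F ∈ E, G = fun x => derivWithin F (Set.Icc a b) x},
          ¬(∀ x ∈ Set.Icc a b, G x = 0) → VanishAtMostW (Set.Icc a b) G n (n - 1)) ↔
      ∃ w : ℕ → ℝ → ℝ, w 0 = (fun _ => (1 : ℝ)) ∧ IsWeightSystem (Set.Icc a b) n w ∧
        (fun F => (Set.Icc a b).restrict F) '' (E : Set (ℝ → ℝ)) =
          (fun F => (Set.Icc a b).restrict F) '' ECspace (Set.Icc a b) n w) := by
  set J := Set.Icc a b with hJdef
  have hJ : UniqueDiffOn ℝ J := uniqueDiffOn_Icc hab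
  have haJ : a ∈ J := ⟨le_rfl, hab.le⟩
  refine ⟨⟨?_, ?_⟩, ⟨?_, ?_⟩⟩
  · intro hEC
    obtain ⟨w, hw, h⟩ := core_sub hab n E hdim hreg fun F hF h0 => vfin_iff.2 (hEC F hF h0)
    refine ⟨w, hw, img_eq_iff.2 ⟨fun F hF => ⟨F, (h F).2 ⟨F, hF, fun _ _ => rfl⟩, fun _ _ => rfl⟩,
      fun F hF => (h F).1 hF⟩⟩
  · rintro ⟨w, hw, himg⟩ F hF hF0
    obtain ⟨G, hG, hGF⟩ := (img_eq_iff.1 himg).1 F hF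
    exact vfin_iff.1 (ec_zeros hab n w hw F (ec_congr hGF hG) fun h => hF0 (hinj F hF h))
  · rintro ⟨h1, hEC⟩
    rcases n with _ | n
    · obtain ⟨G0, hG0, hG01⟩ := h1
      refine ⟨fun _ _ => 1, rfl, fun i _ => ⟨contDiffOn_const, fun _ _ => one_pos⟩,
        img_eq_iff.2 ⟨?_, ?_⟩⟩
      · intro F hF
        refine ⟨F, ⟨hreg F hF, ?_⟩, fun _ _ => rfl⟩
        have hne : (⟨G0, hG0⟩ : E) ≠ 0 := by
          intro h
          have h2 : G0 = 0 := congrArg Subtype.val h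
          have := hG01 a haJ
          rw [h2] at this
          simp at this
        obtain ⟨c, hc⟩ := (finrank_eq_one_iff_of_nonzero' _ hne).1 hdim ⟨F, hF⟩
        have hc' : c • G0 = F := congrArg Subtype.val hc
        refine ⟨c, fun x hx => ?_⟩
        simp [genD, ← hc', hG01 x hx]
      · rintro F ⟨_, c, hc⟩
        refine ⟨c • G0, E.smul_mem _ hG0, fun x hx => ?_⟩
        have := hc x hx
        simp only [genD, div_one] at this
        simp [hG01 x hx, this]
    · obtain ⟨w, hw0, hw, h⟩ := design_forward hab n E hdim hreg hinj h1
        fun F hF h0 => vfin_iff.2 (hEC _ ⟨F, hF, rfl⟩ h0)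
      exact ⟨w, hw0, hw, img_eq_iff.2 ⟨fun F hF => ⟨F, (h F).2 ⟨F, hF, fun _ _ => rfl⟩,
        fun _ _ => rfl⟩, fun F hF => (h F).1 hF⟩⟩
  · rintro ⟨w, hw0, hw, himg⟩
    rw [img_eq_iff] at himg
    rcases n with _ | n
    · constructor
      · refine himg.2 (fun _ => 1) ⟨contDiffOn_const, 1, fun x _ => ?_⟩
        simp [genD, hw0]
      · rintro G _ _ r xs m _ _ q1 q2 _
        refine (Finset.sum_eq_zero fun i _ => ?_).le
        have := q2 i
        omega
    · have hw0' := hw 0 (by omega)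
      rw [Nat.sub_zero] at hw0'
      have hdiv : ∀ F : ℝ → ℝ, (fun x => F x / w 0 x) = F := fun F => by
        funext x
        simp [hw0]
      constructor
      · refine himg.2 (fun _ => 1) ((mem_ec_succ hJ hw0'.1 hw0'.2).2 ⟨contDiffOn_const, ?_⟩)
        rw [hdiv]
        refine ec_congr ?_ (zero_mem_ec n)
        intro x _
        simp
      · rintro _ ⟨F, hF, rfl⟩ h0
        obtain ⟨G, hG, hGF⟩ := himg.1 F hF
        have := ((mem_ec_succ hJ hw0'.1 hw0'.2).1 (ec_congr hGF hG)).2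
        rw [hdiv] at this
        exact vfin_iff.1 (ec_zeros hab n _ (weight_shift hw) _ this h0)
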